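/- Let E be a real Hilbert space, x₁ ∈ E, and d : E → ℝ a function that is differentiable at every point of E \ {x₁} with gradient ∇d(x) ≠ 0 for all x ≠ x₁. Let κ : ℝ → ℝ be differentiable on [0,1) with κ(t) > 0 for t ∈ [0,1) and κ(0) = 1. Suppose x : [0,1) → E is differentiable, x(t) ≠ x₁ for all t ∈ [0,1), and x solves the ODE x'(t) = (κ'(t)/κ(t)) · d(x(t)) · ∇d(x(t)) / ‖∇d(x(t))‖² for all t ∈ [0,1). Then d(x(t)) = κ(t) · d(x(0)) for all t ∈ [0,1). -/

import Mathlib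

open scoped RealInnerProductSpace

/-- A solution of `f' = (κ' / κ) * f` on `[0, 1)` is a multiple of `κ`. -/
theorem div_eq_div_zero_of_hasDerivAt {f κ κ' : ℝ → ℝ}
    (hκ : ∀ t ∈ Set.Ico (0:ℝ) 1, HasDerivAt κ (κ' t) t)
    (hκne : ∀ t ∈ Set.Ico (0:ℝ) 1, κ t ≠ 0)
    (hf : ∀ t ∈ Set.Ico (0:ℝ) 1, HasDerivAt f (κ' t / κ t * f t) t) :
    ∀ t ∈ Set.Ico (0:ℝ) 1, f t / κ t = f 0 / κ 0 := by
  have hquot : ∀ t ∈ Set.Ico (0:ℝ) 1, HasDerivAt (fun s => f s / κ s) 0 t := by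
    intro t ht
    have hne := hκne t ht
    refine ((hf t ht).fun_div (hκ t ht) hne).congr_deriv ?_
    field_simp
    ring
  intro t ht
  refine constant_of_has_deriv_right_zero (f := fun s => f s / κ s) (a := 0) (b := t) ?_ ?_ t
    (Set.right_mem_Icc.2 ht.1)
  · exact fun s hs => (hquot s ⟨hs.1, hs.2.trans_lt ht.2⟩).continuousAt.continuousWithinAt
  · exact fun s hs => (hquot s ⟨hs.1, hs.2.trans ht.2⟩).hasDerivWithinAt

/-- Forward direction of Theorem 1 of "Riemannian Flow Matching on General Geometries"
in the Hilbert-space setting: a solution of the conditional-vector-field ODE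
`x' t = (κ' t / κ t) · d(x t) · ∇d(x t) / ‖∇d(x t)‖²` decreases the premetric `d`
according to the scheduler, `d (x t) = κ t * d (x 0)`. -/
theorem rfm_flow_decreases_premetric
    {E : Type*} [NormedAddCommGroup E] [InnerProductSpace ℝ E] [CompleteSpace E]
    (x₁ : E) (d : E → ℝ) (grad : E → E)
    (hd : ∀ y : E, y ≠ x₁ → HasGradientAt d (grad y) y)
    (hgrad : ∀ y : E, y ≠ x₁ → grad y ≠ 0)
    (κ κ' : ℝ → ℝ)
    (hκ : ∀ t ∈ Set.Ico (0:ℝ) 1, HasDerivAt κ (κ' t) t)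
    (hκpos : ∀ t ∈ Set.Ico (0:ℝ) 1, 0 < κ t)
    (hκ0 : κ 0 = 1)
    (x : ℝ → E) (x' : ℝ → E)
    (hx : ∀ t ∈ Set.Ico (0:ℝ) 1, HasDerivAt x (x' t) t)
    (hne : ∀ t ∈ Set.Ico (0:ℝ) 1, x t ≠ x₁)
    (hode : ∀ t ∈ Set.Ico (0:ℝ) 1,
      x' t = ((κ' t / κ t) * d (x t) / ‖grad (x t)‖ ^ 2) • grad (x t)) :
    ∀ t ∈ Set.Ico (0:ℝ) 1, d (x t) = κ t * d (x 0) := by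
  intro t ht
  have hf : ∀ s ∈ Set.Ico (0:ℝ) 1, HasDerivAt (fun r => d (x r)) (κ' s / κ s * d (x s)) s := by
    intro s hs
    have hnorm : ‖grad (x s)‖ ≠ 0 := norm_ne_zero_iff.2 (hgrad _ (hne s hs))
    have hchain := (hd _ (hne s hs)).hasFDerivAt.comp_hasDerivAt s (hx s hs)
    refine hchain.congr_deriv ?_
    rw [hode s hs, InnerProductSpace.toDual_apply_apply, real_inner_smul_right,
      real_inner_self_eq_norm_sq]
    field_simp
  have hquot := div_eq_div_zero_of_hasDerivAt hκ (fun s hs => (hκpos s hs).ne') hf t ht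
  rw [hκ0, div_one, div_eq_iff (hκpos t ht).ne'] at hquot
  rw [hquot, mul_comm]
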